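/- Let k ≥ 1 and let P ⊆ [0,1]^2 be a point set with |P| = k such that every point p = (p_1,p_2) ∈ P satisfies p_1 p_2 ≥ 1 − 1/k. Then there exists q ∈ [0,1]^2 such that the open anchored box [0,q) contains no point of P and λ(q) ≥ 1 − 1/k; consequently, the L∞ star discrepancy satisfies d*∞(P) ≥ 1 − 1/k. -/

import Mathlib

open scoped Classical

noncomputable section

/-- The volume (Lebesgue measure) of the anchored box `[0, q)` (equivalently `[0,q]`). -/
def vol {d : ℕ} (q : Fin d → ℝ) : ℝ := ∏ j, q j

/-- `x` lies in the open anchored box `[0, q) = ∏_j [0, q_j)`. -/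
def inOpenBox {d : ℕ} (q x : Fin d → ℝ) : Prop := ∀ j, 0 ≤ x j ∧ x j < q j

/-- `x` lies in the closed anchored box `[0, q] = ∏_j [0, q_j]`. -/
def inClosedBox {d : ℕ} (q x : Fin d → ℝ) : Prop := ∀ j, 0 ≤ x j ∧ x j ≤ q j

/-- `δ(q, P) = λ(q) - D(q, P) / |P|`, using the open box `[0, q)`. -/
def delta {d : ℕ} (q : Fin d → ℝ) (P : Finset (Fin d → ℝ)) : ℝ :=
  vol q - ((P.filter (fun x => inOpenBox q x)).card : ℝ) / (P.card : ℝ)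

/-- `δ̄(q, P) = D̄(q, P) / |P| - λ(q)`, using the closed box `[0, q]`. -/
def deltaBar {d : ℕ} (q : Fin d → ℝ) (P : Finset (Fin d → ℝ)) : ℝ :=
  ((P.filter (fun x => inClosedBox q x)).card : ℝ) / (P.card : ℝ) - vol q

/-- The `L∞` star discrepancy `d*∞(P) = sup_{q ∈ [0,1]^d} max (δ(q,P)) (δ̄(q,P))`. -/
def starDisc {d : ℕ} (P : Finset (Fin d → ℝ)) : ℝ :=
  sSup {x : ℝ | ∃ q : Fin d → ℝ,
    (∀ j, 0 ≤ q j ∧ q j ≤ 1) ∧ x = max (delta q P) (deltaBar q P)}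

theorem vol_nonneg {d : ℕ} {q : Fin d → ℝ} (hq : ∀ j, 0 ≤ q j ∧ q j ≤ 1) : 0 ≤ vol q :=
  Finset.prod_nonneg fun j _ => (hq j).1

theorem vol_le_one {d : ℕ} {q : Fin d → ℝ} (hq : ∀ j, 0 ≤ q j ∧ q j ≤ 1) : vol q ≤ 1 :=
  Finset.prod_le_one (fun j _ => (hq j).1) fun j _ => (hq j).2

theorem delta_le_one {d : ℕ} {q : Fin d → ℝ} (hq : ∀ j, 0 ≤ q j ∧ q j ≤ 1)
    (P : Finset (Fin d → ℝ)) : delta q P ≤ 1 :=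
  (sub_le_self _ (by positivity)).trans (vol_le_one hq)

theorem deltaBar_le_one {d : ℕ} {q : Fin d → ℝ} (hq : ∀ j, 0 ≤ q j ∧ q j ≤ 1)
    (P : Finset (Fin d → ℝ)) : deltaBar q P ≤ 1 :=
  (sub_le_self _ (vol_nonneg hq)).trans <|
    div_le_one_of_le₀ (by exact_mod_cast Finset.card_filter_le _ _) (Nat.cast_nonneg _)

theorem delta_le_starDisc {d : ℕ} {q : Fin d → ℝ} (hq : ∀ j, 0 ≤ q j ∧ q j ≤ 1)
    (P : Finset (Fin d → ℝ)) : delta q P ≤ starDisc P := by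
  refine (le_max_left _ (deltaBar q P)).trans (le_csSup ⟨1, ?_⟩ ⟨q, hq, rfl⟩)
  rintro _ ⟨r, hr, rfl⟩
  exact max_le (delta_le_one hr P) (deltaBar_le_one hr P)

theorem delta_eq_vol_of_empty {d : ℕ} {q : Fin d → ℝ} {P : Finset (Fin d → ℝ)}
    (h : ∀ p ∈ P, ¬ inOpenBox q p) : delta q P = vol q := by
  simp [delta, Finset.filter_false_of_mem h]

/-- If all `k` points of `P ⊆ [0,1]^2` lie above the hyperbola `xy = 1 - 1/k`, then there
is an empty open anchored box of volume at least `1 - 1/k`; consequently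
`d*∞(P) ≥ 1 - 1/k`. -/
theorem exists_empty_box_of_above_hyperbola (k : ℕ) (hk : 1 ≤ k)
    (P : Finset (Fin 2 → ℝ)) (hcard : P.card = k)
    (hcube : ∀ p ∈ P, ∀ j, 0 ≤ p j ∧ p j ≤ 1)
    (hhyp : ∀ p ∈ P, 1 - 1 / (k : ℝ) ≤ p 0 * p 1) :
    (∃ q : Fin 2 → ℝ, (∀ j, 0 ≤ q j ∧ q j ≤ 1) ∧
      (∀ p ∈ P, ¬ inOpenBox q p) ∧ 1 - 1 / (k : ℝ) ≤ vol q) ∧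
    1 - 1 / (k : ℝ) ≤ starDisc P := by
  suffices h : ∃ q : Fin 2 → ℝ, (∀ j, 0 ≤ q j ∧ q j ≤ 1) ∧
      (∀ p ∈ P, ¬ inOpenBox q p) ∧ 1 - 1 / (k : ℝ) ≤ vol q by
    obtain ⟨q, hq, hempty, hvol⟩ := h
    exact ⟨⟨q, hq, hempty, hvol⟩,
      (hvol.trans_eq (delta_eq_vol_of_empty hempty).symm).trans (delta_le_starDisc hq P)⟩
  have hk' : 1 / (k : ℝ) ≤ 1 := div_le_one_of_le₀ (by exact_mod_cast hk) (Nat.cast_nonneg k)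
  have hk0 : 0 ≤ 1 / (k : ℝ) := by positivity
  refine ⟨![1 - 1 / (k : ℝ), 1], ?_, fun p hp hbox => ?_, by simp [vol]⟩
  · rw [Fin.forall_fin_two]
    exact ⟨⟨sub_nonneg.2 hk', sub_le_self _ hk0⟩, zero_le_one, le_rfl⟩
  · have hlt : p 0 < 1 - 1 / (k : ℝ) := (hbox 0).2
    have hle : p 0 * p 1 ≤ p 0 := mul_le_of_le_one_right (hcube p hp 0).1 (hcube p hp 1).2
    exact absurd (hhyp p hp) (hle.trans_lt hlt).not_ge
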